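/- Let n ≥ 4 and let C̄_n be the complement graph of the n-cycle on vertices x_1, …, x_n. Let z = x_n, and let Γ' be the defining graph of the kernel of the homomorphism φ : A(C̄_n) → Z/2Z sending x_n to 1 and all other x_i to 0, as produced by the gluing construction (so Γ' has vertices {z²} ∪ {x_1, …, x_{n−1}} ∪ {y_1, y_{n−1}}, where y_i denotes the copy z x_i z⁻¹). Then the induced subgraph of Γ' on the set S = {y_1, x_2, …, x_{n−1}} is isomorphic to C̄_{n−1}: in Γ', the vertex y_1 is non-adjacent to x_i exactly when i ∈ {2, n−1}, and x_i is non-adjacent to x_j exactly when |i − j| ≤ 1. -/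

import Mathlib

/-- The `n`-cycle graph `C_n` on `Fin n` (0-based: the vertex `x_i` of the paper is
`i - 1 : Fin n`): `i` and `j` are adjacent iff they are distinct and differ by `1`
mod `n`. -/
def cycleG (n : ℕ) : SimpleGraph (Fin n) :=
  SimpleGraph.fromRel (fun i j => ((i : ℕ) : ZMod n) - ((j : ℕ) : ZMod n) = 1)

/-- The vertex set of the graph obtained by gluing `n` copies of `Γ ∖ st(z)` to `st(z)`
along `lk(z)`: one vertex `z₀` (standing for `zⁿ`, here `z²`), the vertices of `lk(z)`,
and `n` copies of the vertices outside `st(z)` (the copy `(u, k)` stands for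
`zᵏ u z⁻ᵏ`). -/
def GlueV {V : Type} (G : SimpleGraph V) (z : V) (n : ℕ) : Type :=
  Unit ⊕ {w : V // G.Adj z w} ⊕ ({u : V // u ≠ z ∧ ¬ G.Adj z u} × Fin n)

/-- The adjacency generating relation of the glued graph. -/
def glueRel {V : Type} (G : SimpleGraph V) (z : V) (n : ℕ) :
    GlueV G z n → GlueV G z n → Prop
  | Sum.inl _, Sum.inr (Sum.inl _) => True
  | Sum.inr (Sum.inl w), Sum.inr (Sum.inl w') => G.Adj w w'
  | Sum.inr (Sum.inr (u, k)), Sum.inr (Sum.inr (u', k')) => k = k' ∧ G.Adj u u'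
  | Sum.inr (Sum.inr (u, _)), Sum.inr (Sum.inl w) => G.Adj u w
  | _, _ => False

/-- The graph obtained by gluing `n` copies of `Γ ∖ st(z)` to `st(z)` along `lk(z)`;
for `n = 2` this is the defining graph of the kernel of `φ : A(Γ) → ℤ/2ℤ`. -/
def glueGraph {V : Type} (G : SimpleGraph V) (z : V) (n : ℕ) :
    SimpleGraph (GlueV G z n) :=
  SimpleGraph.fromRel (glueRel G z n)

/-- The relabelling of the vertices of `S = {y₁, x₂, …, x_{n-1}}` by vertices of
`C̄_{n-1}`: `y₁ = z x₁ z⁻¹` plays the role of `x₁`, and each `xᵢ` plays the role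
of `xᵢ` (0-based, so `xᵢ` has index `i - 1`). -/
def glueIdx (n : ℕ) (hn : 4 ≤ n) (z : Fin n) :
    GlueV ((cycleG n)ᶜ) z 2 → Fin (n - 1) := fun v =>
  match v with
  | Sum.inl _ => ⟨0, by omega⟩
  | Sum.inr (Sum.inl w) => ⟨(w.val : ℕ) % (n - 1), Nat.mod_lt _ (by omega)⟩
  | Sum.inr (Sum.inr (u, _)) => ⟨(u.val : ℕ) % (n - 1), Nat.mod_lt _ (by omega)⟩

theorem glueGraph_adj_iff {V : Type} (G : SimpleGraph V) (z : V) (n : ℕ) (a b : GlueV G z n) :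
    (glueGraph G z n).Adj a b ↔ glueRel G z n a b ∨ glueRel G z n b a := by
  rw [glueGraph, SimpleGraph.fromRel_adj]
  refine and_iff_right_of_imp ?_
  rintro h rfl
  rcases a with _ | w | ⟨u, k⟩ <;> simp [glueRel] at h

theorem ZMod.natCast_sub_natCast_eq_one_iff {n i j : ℕ} (hi : i < n) (hj : j < n) :
    (i : ZMod n) - (j : ZMod n) = 1 ↔ i = j + 1 ∨ (i = 0 ∧ j + 1 = n) := by
  have h : (i : ZMod n) - (j : ZMod n) = 1 ↔ (i : ZMod n) = ((j + 1 : ℕ) : ZMod n) := by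
    rw [sub_eq_iff_eq_add', Nat.cast_add, Nat.cast_one]
  rw [h, ZMod.natCast_eq_natCast_iff', Nat.mod_eq_of_lt hi]
  rcases Nat.lt_or_ge (j + 1) n with hlt | hge
  · rw [Nat.mod_eq_of_lt hlt]
    omega
  · obtain rfl : n = j + 1 := by omega
    rw [Nat.mod_self]
    omega

theorem cycleG_compl_adj_iff {n : ℕ} (i j : Fin n) :
    ((cycleG n)ᶜ).Adj i j ↔ (i : ℕ) ≠ j ∧ (i : ℕ) ≠ j + 1 ∧ (j : ℕ) ≠ i + 1 ∧
      ¬ ((i : ℕ) = 0 ∧ (j : ℕ) + 1 = n) ∧ ¬ ((j : ℕ) = 0 ∧ (i : ℕ) + 1 = n) := by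
  rw [SimpleGraph.compl_adj, cycleG, SimpleGraph.fromRel_adj,
    ZMod.natCast_sub_natCast_eq_one_iff i.isLt j.isLt,
    ZMod.natCast_sub_natCast_eq_one_iff j.isLt i.isLt, Ne, Fin.ext_iff]
  tauto

/-- Let `n ≥ 4`, let `z = x_n` be the last vertex of `C̄_n`, and let `Γ'` be
the defining graph of `ker (φ : A(C̄_n) → ℤ/2ℤ)` produced by the gluing construction
(two copies of `Γ ∖ st(z)` glued to `st(z)` along `lk(z)`).  Then on the vertex set
`S = {y₁, x₂, …, x_{n-1}}` — where `y₁ = z x₁ z⁻¹` is the second copy of `x₁` and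
`x_{n-1}` is taken in the first copy — the induced subgraph of `Γ'` is isomorphic to
`C̄_{n-1}`, adjacency in `Γ'` on `S` corresponding exactly to adjacency in `C̄_{n-1}`
under the relabelling `glueIdx` (so `y₁` is non-adjacent to `xᵢ` exactly for
`i ∈ {2, n-1}`, and `xᵢ`, `xⱼ` are non-adjacent exactly when `|i - j| ≤ 1`). -/
theorem induced_subgraph_of_glued_compl_cycle (n : ℕ) (hn : 4 ≤ n)
    (z : Fin n) (hz : (z : ℕ) = n - 1) :
    let Γ' := glueGraph ((cycleG n)ᶜ) z 2
    let S : Set (GlueV ((cycleG n)ᶜ) z 2) :=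
      {v | match v with
           | Sum.inl _ => False
           | Sum.inr (Sum.inl _) => True
           | Sum.inr (Sum.inr (u, k)) =>
               ((u.val : ℕ) = 0 ∧ k = 1) ∨ ((u.val : ℕ) = n - 2 ∧ k = 0)}
    (∀ a ∈ S, ∀ b ∈ S,
        Γ'.Adj a b ↔ ((cycleG (n - 1))ᶜ).Adj (glueIdx n hn z a) (glueIdx n hn z b)) ∧
    Nonempty ((Γ'.induce S) ≃g ((cycleG (n - 1))ᶜ)) := by
  intro Γ' S
  have hlk : ∀ w : Fin n, ((cycleG n)ᶜ).Adj z w ↔ 1 ≤ (w : ℕ) ∧ (w : ℕ) ≤ n - 3 := by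
    intro w
    rw [cycleG_compl_adj_iff]
    omega
  have hadj : ∀ a ∈ S, ∀ b ∈ S,
      Γ'.Adj a b ↔ ((cycleG (n - 1))ᶜ).Adj (glueIdx n hn z a) (glueIdx n hn z b) := by
    intro a ha b hb
    rw [cycleG_compl_adj_iff]
    rw [glueGraph_adj_iff]
    rcases a with _ | ⟨w, hw⟩ | ⟨⟨u, hu⟩, k⟩
    · exact ha.elim
    · have hw' := (hlk w).1 hw
      have hwm : (w : ℕ) % (n - 1) = w := Nat.mod_eq_of_lt (by omega)
      rcases b with _ | ⟨v, hv⟩ | ⟨⟨v, hv⟩, l⟩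
      · exact hb.elim
      · have hv' := (hlk v).1 hv
        have hvm : (v : ℕ) % (n - 1) = v := Nat.mod_eq_of_lt (by omega)
        simp only [glueRel, glueIdx, cycleG_compl_adj_iff, hwm, hvm]
        omega
      · have hvm : (v : ℕ) % (n - 1) = v := Nat.mod_eq_of_lt (by rcases hb with h | h <;> omega)
        simp only [glueRel, glueIdx, cycleG_compl_adj_iff, hwm, hvm, false_or]
        rcases hb with ⟨h, -⟩ | ⟨h, -⟩ <;> simp only at h <;> omega
    · have hum : (u : ℕ) % (n - 1) = u := Nat.mod_eq_of_lt (by rcases ha with h | h <;> omega)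
      rcases b with _ | ⟨v, hv⟩ | ⟨⟨v, hv⟩, l⟩
      · exact hb.elim
      · have hv' := (hlk v).1 hv
        have hvm : (v : ℕ) % (n - 1) = v := Nat.mod_eq_of_lt (by omega)
        simp only [glueRel, glueIdx, cycleG_compl_adj_iff, hum, hvm, or_false]
        rcases ha with ⟨h, -⟩ | ⟨h, -⟩ <;> simp only at h <;> omega
      · have hvm : (v : ℕ) % (n - 1) = v := Nat.mod_eq_of_lt (by rcases hb with h | h <;> omega)
        simp only [glueRel, glueIdx, cycleG_compl_adj_iff, hum, hvm]
        rcases ha with ⟨h, rfl⟩ | ⟨h, rfl⟩ <;> rcases hb with ⟨h', rfl⟩ | ⟨h', rfl⟩ <;>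
          simp only at h h' <;> simp [h, h'] <;> omega
  refine ⟨hadj, ⟨⟨Equiv.ofBijective (fun a : S => glueIdx n hn z a) ⟨?_, ?_⟩, ?_⟩⟩⟩
  · rintro ⟨a, ha⟩ ⟨b, hb⟩ hab
    refine Subtype.ext ?_
    have hval := congrArg Fin.val hab
    rcases a with _ | ⟨w, hw⟩ | ⟨⟨u, hu⟩, k⟩
    · exact ha.elim
    · have hw' := (hlk w).1 hw
      have hwm : (w : ℕ) % (n - 1) = w := Nat.mod_eq_of_lt (by omega)
      rcases b with _ | ⟨v, hv⟩ | ⟨⟨v, hv⟩, l⟩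
      · exact hb.elim
      · have hv' := (hlk v).1 hv
        have hvm : (v : ℕ) % (n - 1) = v := Nat.mod_eq_of_lt (by omega)
        simp only [glueIdx, hwm, hvm] at hval
        obtain rfl := Fin.ext hval
        rfl
      · have hvm : (v : ℕ) % (n - 1) = v := Nat.mod_eq_of_lt (by rcases hb with h | h <;> omega)
        simp only [glueIdx, hwm, hvm] at hval
        rcases hb with ⟨h, -⟩ | ⟨h, -⟩ <;> simp only at h <;> omega
    · have hum : (u : ℕ) % (n - 1) = u := Nat.mod_eq_of_lt (by rcases ha with h | h <;> omega)
      rcases b with _ | ⟨v, hv⟩ | ⟨⟨v, hv⟩, l⟩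
      · exact hb.elim
      · have hv' := (hlk v).1 hv
        have hvm : (v : ℕ) % (n - 1) = v := Nat.mod_eq_of_lt (by omega)
        simp only [glueIdx, hum, hvm] at hval
        rcases ha with ⟨h, -⟩ | ⟨h, -⟩ <;> simp only at h <;> omega
      · have hvm : (v : ℕ) % (n - 1) = v := Nat.mod_eq_of_lt (by rcases hb with h | h <;> omega)
        simp only [glueIdx, hum, hvm] at hval
        obtain rfl := Fin.ext hval
        rcases ha with ⟨h, rfl⟩ | ⟨h, rfl⟩ <;> rcases hb with ⟨h', rfl⟩ | ⟨h', rfl⟩ <;>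
          simp only at h h' <;> first | rfl | omega
  · rintro ⟨i, hi⟩
    have him : i % (n - 1) = i := Nat.mod_eq_of_lt hi
    have hin : i < n := by omega
    have hout : ¬ (1 ≤ i ∧ i ≤ n - 3) →
        (⟨i, hin⟩ : Fin n) ≠ z ∧ ¬ ((cycleG n)ᶜ).Adj z ⟨i, hin⟩ := fun h =>
      ⟨fun he => by have := congrArg Fin.val he; simp only at this; omega,
        fun h' => h ((hlk _).1 h')⟩
    by_cases h0 : i = 0
    · exact ⟨⟨Sum.inr (Sum.inr (⟨⟨i, hin⟩, hout (by omega)⟩, 1)), Or.inl ⟨h0, rfl⟩⟩, Fin.ext him⟩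
    by_cases h1 : i = n - 2
    · exact ⟨⟨Sum.inr (Sum.inr (⟨⟨i, hin⟩, hout (by omega)⟩, 0)), Or.inr ⟨h1, rfl⟩⟩, Fin.ext him⟩
    exact ⟨⟨Sum.inr (Sum.inl ⟨⟨i, hin⟩, (hlk _).2 ⟨by simp only; omega, by simp only; omega⟩⟩),
      trivial⟩, Fin.ext him⟩
  · rintro ⟨a, ha⟩ ⟨b, hb⟩
    exact (hadj a ha b hb).symm
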